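/- arXiv:2502.15659 — 3 statements merged into one kernel-verified Lean document; each statement's English description precedes it below -/
import Mathlib

section
/- Let A₁ ⊆ PSD(ℂ^{d₁}), A₂ ⊆ PSD(ℂ^{d₂}) and A₁₂ ⊆ PSD(ℂ^{d₁} ⊗ ℂ^{d₂}) be nonempty compact sets of positive semidefinite matrices. Then the restricted polar sets are closed under tensor product, i.e. Y₁ ⊗ Y₂ ∈ (A₁₂)°₊ for all Y₁ ∈ (A₁)°₊ and Y₂ ∈ (A₂)°₊, if and only if the support functions are sub-multiplicative, i.e. h_{A₁₂}(X₁ ⊗ X₂) ≤ h_{A₁}(X₁) · h_{A₂}(X₂) for all positive semidefinite X₁ (on ℂ^{d₁}) and X₂ (on ℂ^{d₂}). -/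
open scoped Kronecker ComplexOrder Matrix

attribute [local instance] Classical.propDecidable

noncomputable section

namespace QIT

variable {n : Type*} [Fintype n] [DecidableEq n]

/-- Base-2 matrix logarithm taken on the support (junk value `0` for non-Hermitian input). -/
def matLog (A : Matrix n n ℂ) : Matrix n n ℂ :=
  if hA : A.IsHermitian then
    (hA.eigenvectorUnitary : Matrix n n ℂ) *
      Matrix.diagonal (fun i => if hA.eigenvalues i = 0 then (0 : ℂ)
        else (Real.logb 2 (hA.eigenvalues i) : ℂ)) *
      (hA.eigenvectorUnitary : Matrix n n ℂ)ᴴ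
  else 0

/-- Orthogonal projection onto the support of a Hermitian matrix. -/
def suppProj (A : Matrix n n ℂ) : Matrix n n ℂ :=
  if hA : A.IsHermitian then
    (hA.eigenvectorUnitary : Matrix n n ℂ) *
      Matrix.diagonal (fun i => if hA.eigenvalues i = 0 then (0 : ℂ) else 1) *
      (hA.eigenvectorUnitary : Matrix n n ℂ)ᴴ
  else 0

/-- Support inclusion `supp ρ ⊆ supp σ`, phrased via kernels. -/
def suppLE (ρ σ : Matrix n n ℂ) : Prop :=
  ∀ x : n → ℂ, σ.mulVec x = 0 → ρ.mulVec x = 0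

/-- Umegaki relative entropy (base 2), `+∞` when supports are not included. -/
def relEnt (ρ σ : Matrix n n ℂ) : EReal :=
  if suppLE ρ σ then (((ρ * (matLog ρ - matLog σ)).trace).re : EReal) else ⊤

/-- Classical relative-entropy summand `p log₂(p/q)` with conventions
`0 · log(0/q) = 0` and `p · log(p/0) = +∞` for `p ≠ 0`. -/
def klTerm (p q : ℝ) : EReal :=
  if p = 0 then 0 else if q = 0 then ⊤ else ((p * Real.logb 2 (p / q) : ℝ) : EReal)

/-- A finite POVM. -/
def IsPOVM {m : ℕ} (M : Fin m → Matrix n n ℂ) : Prop :=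
  (∀ x, (M x).PosSemidef) ∧ ∑ x, M x = 1

/-- Measured relative entropy (base 2). -/
def measRelEnt (ρ σ : Matrix n n ℂ) : EReal :=
  ⨆ (m : ℕ) (M : Fin m → Matrix n n ℂ) (_ : IsPOVM M),
    ∑ x, klTerm ((M x * ρ).trace).re ((M x * σ).trace).re

/-- Trace norm: sum of singular values. -/
def traceNorm (A : Matrix n n ℂ) : ℝ :=
  ∑ i, Real.sqrt ((Matrix.posSemidef_conjTranspose_mul_self A).1.eigenvalues i)

/-- Operator (spectral) norm: largest singular value. -/
def opNorm (A : Matrix n n ℂ) : ℝ :=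
  ⨆ i, Real.sqrt ((Matrix.posSemidef_conjTranspose_mul_self A).1.eigenvalues i)

/-- Partial transpose on the second tensor factor. -/
def ptB {α β : Type*} (X : Matrix (α × β) (α × β) ℂ) : Matrix (α × β) (α × β) ℂ :=
  Matrix.of fun p q => X (p.1, q.2) (q.1, p.2)

/-- Kronecker product of two bipartite matrices, reindexed to the bipartition (A×A') : (B×B'). -/
def kron2 {α β γ δ : Type*} (X : Matrix (α × β) (α × β) ℂ) (Y : Matrix (γ × δ) (γ × δ) ℂ) :
    Matrix ((α × γ) × β × δ) ((α × γ) × β × δ) ℂ :=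
  Matrix.reindex (Equiv.prodProdProdComm α β γ δ) (Equiv.prodProdProdComm α β γ δ) (X ⊗ₖ Y)

/-- The permutation unitary on `(ℂ^d)^{⊗ m}`. -/
def permMat (d m : ℕ) (π : Equiv.Perm (Fin m)) :
    Matrix (Fin m → Fin d) (Fin m → Fin d) ℂ :=
  Matrix.of fun f g => if f ∘ π = g then 1 else 0

/-- Membership in the `PPT_k` set. -/
def memPPTk {α β : Type*} [Fintype α] [Fintype β] [DecidableEq α] [DecidableEq β]
    (k : ℕ) (X : Matrix (α × β) (α × β) ℂ) : Prop :=
  X.PosSemidef ∧ ∃ ω : ℕ → Matrix (α × β) (α × β) ℂ,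
    ω 1 = X ∧ (∀ i ∈ Finset.Icc 1 k, (ω i).IsHermitian) ∧
    (∀ i ∈ Finset.Icc 1 (k - 1),
      ((ω (i + 1)) - ptB (ω i)).PosSemidef ∧ ((ω (i + 1)) + ptB (ω i)).PosSemidef) ∧
    traceNorm (ptB (ω k)) ≤ 1

/-- Membership in the Rains set. -/
def memRains {α β : Type*} [Fintype α] [Fintype β] [DecidableEq α] [DecidableEq β]
    (σ : Matrix (α × β) (α × β) ℂ) : Prop :=
  σ.PosSemidef ∧ traceNorm (ptB σ) ≤ 1


/-- The polar set restricted to positive semidefinite matrices. -/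
def polarPlus {I : Type*} [Fintype I] [DecidableEq I] (C : Set (Matrix I I ℂ)) :
    Set (Matrix I I ℂ) :=
  {X | X.PosSemidef ∧ ∀ Y ∈ C, ((X * Y).trace).re ≤ 1}

/-- The support function `h_C(ω) = sup_{σ ∈ C} tr[σ ω]`. -/
def suppFn {I : Type*} [Fintype I] [DecidableEq I] (C : Set (Matrix I I ℂ))
    (ω : Matrix I I ℂ) : ℝ :=
  sSup {r : ℝ | ∃ σ ∈ C, r = ((σ * ω).trace).re}

open scoped MatrixOrder in
/-- The trace pairing of two positive semidefinite matrices is nonnegative. -/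
theorem re_trace_mul_nonneg {I : Type*} [Fintype I] [DecidableEq I] {A B : Matrix I I ℂ}
    (hA : A.PosSemidef) (hB : B.PosSemidef) : 0 ≤ ((A * B).trace).re := by
  obtain ⟨C, rfl⟩ := CStarAlgebra.nonneg_iff_eq_star_mul_self.mp hB.nonneg
  have h := (hA.mul_mul_conjTranspose_same C).trace_nonneg
  rw [Matrix.mul_assoc, Matrix.trace_mul_comm, Matrix.mul_assoc] at h
  exact (Complex.le_def.mp h).1

theorem bddAbove_trace_mul {I : Type*} [Fintype I] [DecidableEq I] {C : Set (Matrix I I ℂ)}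
    (hC : IsCompact C) (ω : Matrix I I ℂ) :
    BddAbove {r : ℝ | ∃ σ ∈ C, r = ((σ * ω).trace).re} := by
  have hcont : Continuous fun σ : Matrix I I ℂ => ((σ * ω).trace).re :=
    Complex.continuous_re.comp (continuous_id.matrix_mul continuous_const).matrix_trace
  obtain ⟨b, hb⟩ := (hC.image hcont).bddAbove
  refine ⟨b, ?_⟩
  rintro _ ⟨σ, hσ, rfl⟩
  exact hb ⟨σ, hσ, rfl⟩

theorem re_trace_mul_le_suppFn {I : Type*} [Fintype I] [DecidableEq I]
    {C : Set (Matrix I I ℂ)} (hC : IsCompact C) {σ : Matrix I I ℂ} (hσ : σ ∈ C)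
    (ω : Matrix I I ℂ) : ((σ * ω).trace).re ≤ suppFn C ω :=
  le_csSup (bddAbove_trace_mul hC ω) ⟨σ, hσ, rfl⟩

theorem suppFn_le {I : Type*} [Fintype I] [DecidableEq I] {C : Set (Matrix I I ℂ)}
    (hne : C.Nonempty) {ω : Matrix I I ℂ} {b : ℝ}
    (h : ∀ σ ∈ C, ((σ * ω).trace).re ≤ b) : suppFn C ω ≤ b := by
  obtain ⟨σ, hσ⟩ := hne
  refine csSup_le ⟨_, σ, hσ, rfl⟩ ?_
  rintro _ ⟨τ, hτ, rfl⟩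
  exact h τ hτ

theorem suppFn_nonneg {I : Type*} [Fintype I] [DecidableEq I] {C : Set (Matrix I I ℂ)}
    (hpos : ∀ X ∈ C, X.PosSemidef) {ω : Matrix I I ℂ} (hω : ω.PosSemidef) :
    0 ≤ suppFn C ω := by
  refine Real.sSup_nonneg ?_
  rintro _ ⟨σ, hσ, rfl⟩
  exact re_trace_mul_nonneg (hpos σ hσ) hω

/-- The restricted polar is the positive semidefinite part of the unit sublevel set of the
support function. -/
theorem mem_polarPlus_iff {I : Type*} [Fintype I] [DecidableEq I] {C : Set (Matrix I I ℂ)}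
    (hne : C.Nonempty) (hC : IsCompact C) {X : Matrix I I ℂ} :
    X ∈ polarPlus C ↔ X.PosSemidef ∧ suppFn C X ≤ 1 := by
  refine and_congr_right fun _ => ⟨fun h => suppFn_le hne fun σ hσ => ?_, fun h σ hσ => ?_⟩
  · rw [Matrix.trace_mul_comm]
    exact h σ hσ
  · rw [Matrix.trace_mul_comm]
    exact (re_trace_mul_le_suppFn hC hσ X).trans h

theorem inv_smul_mem_polarPlus {I : Type*} [Fintype I] [DecidableEq I]
    {C : Set (Matrix I I ℂ)} (hC : IsCompact C) {X : Matrix I I ℂ} (hX : X.PosSemidef)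
    {a : ℝ} (ha : 0 < a) (h : suppFn C X ≤ a) : a⁻¹ • X ∈ polarPlus C := by
  refine ⟨hX.smul (inv_nonneg.mpr ha.le), fun σ hσ => ?_⟩
  rw [Matrix.smul_mul, Matrix.trace_smul, Complex.smul_re, smul_eq_mul,
    inv_mul_le_one₀ ha, Matrix.trace_mul_comm]
  exact (re_trace_mul_le_suppFn hC hσ X).trans h

/-- the restricted polar sets are closed under tensor product iff the support
functions are sub-multiplicative. -/
theorem polar_tensor_iff_suppFn_submult {d₁ d₂ : ℕ}
    (A1 : Set (Matrix (Fin d₁) (Fin d₁) ℂ)) (A2 : Set (Matrix (Fin d₂) (Fin d₂) ℂ))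
    (A12 : Set (Matrix (Fin d₁ × Fin d₂) (Fin d₁ × Fin d₂) ℂ))
    (hA1 : ∀ X ∈ A1, X.PosSemidef) (hA2 : ∀ X ∈ A2, X.PosSemidef)
    (hA12 : ∀ X ∈ A12, X.PosSemidef)
    (hne1 : A1.Nonempty) (hne2 : A2.Nonempty) (hne12 : A12.Nonempty)
    (hc1 : IsCompact A1) (hc2 : IsCompact A2) (hc12 : IsCompact A12) :
    (∀ Y1 ∈ polarPlus A1, ∀ Y2 ∈ polarPlus A2, Y1 ⊗ₖ Y2 ∈ polarPlus A12) ↔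
      (∀ (X1 : Matrix (Fin d₁) (Fin d₁) ℂ) (X2 : Matrix (Fin d₂) (Fin d₂) ℂ),
        X1.PosSemidef → X2.PosSemidef →
        suppFn A12 (X1 ⊗ₖ X2) ≤ suppFn A1 X1 * suppFn A2 X2) := by
  constructor
  · intro h X1 X2 hX1 hX2
    refine suppFn_le hne12 fun σ hσ => ?_
    have h1 := suppFn_nonneg hA1 hX1
    have h2 := suppFn_nonneg hA2 hX2
    have key : ∀ ε : ℝ, 0 < ε →
        ((σ * (X1 ⊗ₖ X2)).trace).re ≤ (suppFn A1 X1 + ε) * (suppFn A2 X2 + ε) := by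
      intro ε hε
      have ha : 0 < suppFn A1 X1 + ε := by positivity
      have hb : 0 < suppFn A2 X2 + ε := by positivity
      have hmem := h _ (inv_smul_mem_polarPlus hc1 hX1 ha (by linarith))
        _ (inv_smul_mem_polarPlus hc2 hX2 hb (by linarith))
      have ht := hmem.2 σ hσ
      rwa [Matrix.smul_kronecker, Matrix.kronecker_smul, smul_smul, ← mul_inv,
        Matrix.smul_mul, Matrix.trace_smul, Complex.smul_re, smul_eq_mul,
        inv_mul_le_one₀ (mul_pos ha hb), Matrix.trace_mul_comm] at ht
    have hcont : Continuous fun ε : ℝ => (suppFn A1 X1 + ε) * (suppFn A2 X2 + ε) := by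
      fun_prop
    have hlim := (hcont.tendsto 0).mono_left (nhdsWithin_le_nhds (s := Set.Ioi 0))
    simp only [add_zero] at hlim
    exact ge_of_tendsto hlim (Filter.eventually_of_mem self_mem_nhdsWithin key)
  · intro h Y1 hY1 Y2 hY2
    rw [mem_polarPlus_iff hne1 hc1] at hY1
    rw [mem_polarPlus_iff hne2 hc2] at hY2
    rw [mem_polarPlus_iff hne12 hc12]
    exact ⟨hY1.1.kronecker hY2.1, (h Y1 Y2 hY1.1 hY2.1).trans
      (mul_le_one₀ hY1.2 (suppFn_nonneg hA2 hY2.1) hY2.2)⟩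

end QIT
end
end

section
/- Let s, d, f, m ≥ 1. Let Π be a real-linear map from Hermitian matrices on (ℂ^s)^{⊗m} to Hermitian matrices on (ℂ^d)^{⊗m}, F a real-linear map from Hermitian matrices on (ℂ^s)^{⊗m} to Hermitian matrices on (ℂ^f)^{⊗m}, and g a Hermitian matrix on (ℂ^f)^{⊗m}, satisfying for every π ∈ S_m and every X: Π(P_π X P_π†) = P_π Π(X) P_π†, F(P_π X P_π†) = P_π F(X) P_π†, and P_π g P_π† = g (with P_π the tensor-factor permutation unitary on the respective space). Define A := {Π(X) : X positive semidefinite on (ℂ^s)^{⊗m}, F(X) = g}. Then A ∩ I_m = {Π(X) : X positive semidefinite and permutation invariant, F(X) = g}, where I_m denotes the permutation-invariant matrices on (ℂ^d)^{⊗m}. -/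
open scoped Kronecker ComplexOrder Matrix

attribute [local instance] Classical.propDecidable

noncomputable section

namespace QIT

variable {n : Type*} [Fintype n] [DecidableEq n]

/-- `permMat` is multiplicative. -/
theorem permMat_mul (d m : ℕ) (π σ : Equiv.Perm (Fin m)) :
    permMat d m (π * σ) = permMat d m π * permMat d m σ := by
  ext f h
  simp only [permMat, Matrix.mul_apply, Matrix.of_apply, ite_mul, one_mul, zero_mul]
  rw [Finset.sum_ite_eq, if_pos (Finset.mem_univ _)]
  rfl

/-- Conjugating by `permMat` successively amounts to conjugating by the product. -/
theorem permMat_mul_conj (d m : ℕ) (π σ : Equiv.Perm (Fin m))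
    (X : Matrix (Fin m → Fin d) (Fin m → Fin d) ℂ) :
    permMat d m π * (permMat d m σ * X * (permMat d m σ)ᴴ) * (permMat d m π)ᴴ =
      permMat d m (π * σ) * X * (permMat d m (π * σ))ᴴ := by
  simp only [permMat_mul, Matrix.conjTranspose_mul, Matrix.mul_assoc]

/-- The average of a matrix over the conjugation action of the symmetric group. -/
def permTwirl (d m : ℕ) (X : Matrix (Fin m → Fin d) (Fin m → Fin d) ℂ) :
    Matrix (Fin m → Fin d) (Fin m → Fin d) ℂ :=
  (Fintype.card (Equiv.Perm (Fin m)) : ℝ)⁻¹ •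
    ∑ σ : Equiv.Perm (Fin m), permMat d m σ * X * (permMat d m σ)ᴴ

theorem permTwirl_posSemidef {d m : ℕ} {X : Matrix (Fin m → Fin d) (Fin m → Fin d) ℂ}
    (hX : X.PosSemidef) : (permTwirl d m X).PosSemidef := by
  have h : (∑ σ : Equiv.Perm (Fin m), permMat d m σ * X * (permMat d m σ)ᴴ).PosSemidef :=
    Matrix.posSemidef_sum _ fun σ _ => hX.mul_mul_conjTranspose_same _
  exact h.smul (by positivity)

theorem permTwirl_invariant (d m : ℕ) (X : Matrix (Fin m → Fin d) (Fin m → Fin d) ℂ)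
    (π : Equiv.Perm (Fin m)) :
    permMat d m π * permTwirl d m X * (permMat d m π)ᴴ = permTwirl d m X := by
  simp only [permTwirl, Matrix.mul_smul, Matrix.smul_mul, Matrix.mul_sum, Matrix.sum_mul,
    permMat_mul_conj]
  exact congrArg _
    (Equiv.sum_comp (Equiv.mulLeft π) fun σ => permMat d m σ * X * (permMat d m σ)ᴴ)

/-- An equivariant real-linear map sends the twirl of `X` to the image of `X` whenever that image
is permutation invariant. -/
theorem map_permTwirl_eq {s d m : ℕ}
    {G : Matrix (Fin m → Fin s) (Fin m → Fin s) ℂ → Matrix (Fin m → Fin d) (Fin m → Fin d) ℂ}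
    (hG : IsLinearMap ℝ G)
    (hequi : ∀ (π : Equiv.Perm (Fin m)) (X : Matrix (Fin m → Fin s) (Fin m → Fin s) ℂ),
      G (permMat s m π * X * (permMat s m π)ᴴ) = permMat d m π * G X * (permMat d m π)ᴴ)
    {X : Matrix (Fin m → Fin s) (Fin m → Fin s) ℂ}
    (hX : ∀ π : Equiv.Perm (Fin m), permMat d m π * G X * (permMat d m π)ᴴ = G X) :
    G (permTwirl s m X) = G X := by
  have hsum : G (∑ σ : Equiv.Perm (Fin m), permMat s m σ * X * (permMat s m σ)ᴴ) =
      ∑ σ : Equiv.Perm (Fin m), G (permMat s m σ * X * (permMat s m σ)ᴴ) :=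
    map_sum (IsLinearMap.mk' G hG) _ _
  have hcard : (Fintype.card (Equiv.Perm (Fin m)) : ℝ) ≠ 0 :=
    Nat.cast_ne_zero.mpr Fintype.card_ne_zero
  rw [permTwirl, hG.map_smul, hsum]
  simp only [hequi, hX, Finset.sum_const, Finset.card_univ]
  rw [← Nat.cast_smul_eq_nsmul ℝ, smul_smul, inv_mul_cancel₀ hcard, one_smul]

/-- SDP representation of the intersection with the permutation-invariant
algebra, under equivariance of the representing maps. -/
theorem sdp_representation_invariant_intersection (s d f m : ℕ)
    (hs : 1 ≤ s) (hd : 1 ≤ d) (hf : 1 ≤ f) (hm : 1 ≤ m)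
    (Φ : Matrix (Fin m → Fin s) (Fin m → Fin s) ℂ → Matrix (Fin m → Fin d) (Fin m → Fin d) ℂ)
    (F : Matrix (Fin m → Fin s) (Fin m → Fin s) ℂ → Matrix (Fin m → Fin f) (Fin m → Fin f) ℂ)
    (g : Matrix (Fin m → Fin f) (Fin m → Fin f) ℂ)
    (hΦlin : IsLinearMap ℝ Φ) (hFlin : IsLinearMap ℝ F)
    (hΦherm : ∀ X : Matrix (Fin m → Fin s) (Fin m → Fin s) ℂ,
      X.IsHermitian → (Φ X).IsHermitian)
    (hFherm : ∀ X : Matrix (Fin m → Fin s) (Fin m → Fin s) ℂ,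
      X.IsHermitian → (F X).IsHermitian)
    (hgherm : g.IsHermitian)
    (hΦequi : ∀ (π : Equiv.Perm (Fin m)) (X : Matrix (Fin m → Fin s) (Fin m → Fin s) ℂ),
      Φ (permMat s m π * X * (permMat s m π)ᴴ) = permMat d m π * Φ X * (permMat d m π)ᴴ)
    (hFequi : ∀ (π : Equiv.Perm (Fin m)) (X : Matrix (Fin m → Fin s) (Fin m → Fin s) ℂ),
      F (permMat s m π * X * (permMat s m π)ᴴ) = permMat f m π * F X * (permMat f m π)ᴴ)
    (hginv : ∀ π : Equiv.Perm (Fin m), permMat f m π * g * (permMat f m π)ᴴ = g) :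
    {Y | ∃ X : Matrix (Fin m → Fin s) (Fin m → Fin s) ℂ,
        X.PosSemidef ∧ F X = g ∧ Y = Φ X} ∩
      {Y | ∀ π : Equiv.Perm (Fin m), permMat d m π * Y * (permMat d m π)ᴴ = Y} =
    {Y | ∃ X : Matrix (Fin m → Fin s) (Fin m → Fin s) ℂ,
        X.PosSemidef ∧ (∀ π : Equiv.Perm (Fin m), permMat s m π * X * (permMat s m π)ᴴ = X) ∧
        F X = g ∧ Y = Φ X} := by
  ext Y
  constructor
  · rintro ⟨⟨X, hX, hFX, rfl⟩, hY⟩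
    refine ⟨permTwirl s m X, permTwirl_posSemidef hX, permTwirl_invariant s m X, ?_, ?_⟩
    · rw [map_permTwirl_eq hFlin hFequi (fun π => by rw [hFX, hginv π]), hFX]
    · exact (map_permTwirl_eq hΦlin hΦequi hY).symm
  · rintro ⟨X, hX, hinv, hFX, rfl⟩
    refine ⟨⟨X, hX, hFX, rfl⟩, fun π => ?_⟩
    rw [← hΦequi, hinv π]

end QIT
end
end

section
/- Let Π be a real-linear map from Hermitian s×s matrices to Hermitian d×d matrices, F a real-linear map from Hermitian s×s matrices to Hermitian f×f matrices, and g a Hermitian f×f matrix. Define C := {Π(X) : X positive semidefinite s×s, F(X) = g}, and assume strict feasibility: there exists a positive definite X₀ with F(X₀) = g. Then for every Hermitian d×d matrix w and every t ∈ ℝ: h_C(w) ≤ t if and only if there exists a Hermitian f×f matrix λ with tr[λ g] ≤ t and F*(λ) − Π*(w) positive semidefinite, where F* and Π* are the adjoints of F and Π with respect to the trace inner product (i.e. tr[F*(λ) X] = tr[λ F(X)] and tr[Π*(w) X] = tr[w Π(X)] for all Hermitian X). -/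
open scoped Kronecker ComplexOrder Matrix

attribute [local instance] Classical.propDecidable

noncomputable section

namespace QIT

variable {n : Type*} [Fintype n] [DecidableEq n]

/-- Lagrange duality for a conic program with a strictly feasible point `x₀`: an upper bound on
a linear objective over the feasible set is certified by a dual functional. -/
theorem exists_dual_certificate {E V : Type*} [AddCommGroup E] [Module ℝ E]
    [AddCommGroup V] [Module ℝ V] (F : E →ₗ[ℝ] V) (p : E →ₗ[ℝ] ℝ) (K : PointedCone ℝ E)
    (x₀ : E) (hx₀ : x₀ ∈ K) (hint : ∀ y, ∃ r : ℝ, r • x₀ + y ∈ K) (t : ℝ)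
    (h : ∀ x ∈ K, F x = F x₀ → p x ≤ t) :
    ∃ l : Module.Dual ℝ V, l (F x₀) ≤ t ∧ ∀ x ∈ K, p x ≤ l (F x) := by
  have hsmul {c : ℝ} (hc : 0 ≤ c) {x : E} (hx : x ∈ K) : c • x ∈ K :=
    PointedCone.smul_mem K hc hx
  have hrec : ∀ x ∈ K, F x = 0 → p x ≤ 0 := by
    intro x hx hFx
    by_contra! hpos
    have hr : 0 ≤ (|t - p x₀| + 1) / p x := by positivity
    have := h (x₀ + ((|t - p x₀| + 1) / p x) • x) (K.add_mem hx₀ (hsmul hr hx)) (by simp [hFx])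
    simp only [map_add, map_smul, smul_eq_mul, div_mul_cancel₀ _ hpos.ne'] at this
    linarith [le_abs_self (t - p x₀)]
  have hhom : ∀ x ∈ K, ∀ c : ℝ, 0 ≤ c → F x = c • F x₀ → p x ≤ c * t := by
    intro x hx c hc hFx
    rcases hc.eq_or_lt with rfl | hc
    · simpa using hrec x hx (by simpa using hFx)
    · have := h (c⁻¹ • x) (hsmul (inv_nonneg.2 hc.le) hx)
        (by simp [hFx, smul_smul, inv_mul_cancel₀ hc.ne'])
      rwa [map_smul, smul_eq_mul, inv_mul_le_iff₀ hc] at this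
  let D : Submodule ℝ (E × ℝ) := LinearMap.ker
    (F ∘ₗ LinearMap.fst ℝ E ℝ - (LinearMap.snd ℝ E ℝ).smulRight (F x₀))
  have hD (x : E) (c : ℝ) : (x, c) ∈ D ↔ F x = c • F x₀ := by simp [D, sub_eq_zero]
  let q₀ : E × ℝ →ₗ.[ℝ] ℝ :=
    ⟨D, (t • LinearMap.snd ℝ E ℝ - p ∘ₗ LinearMap.fst ℝ E ℝ).domRestrict D⟩
  have hS (x : E) (c : ℝ) : (x, c) ∈ Submodule.prod K (PointedCone.positive ℝ ℝ) ↔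
      x ∈ K ∧ 0 ≤ c := by simp [Submodule.mem_prod]
  obtain ⟨q, hq, hqpos⟩ := riesz_extension (Submodule.prod K (PointedCone.positive ℝ ℝ)) q₀
    (by
      rintro ⟨⟨x, c⟩, hxD⟩ hxK
      obtain ⟨hx, hc⟩ := (hS x c).1 hxK
      have := hhom x hx c hc ((hD x c).1 hxD)
      change 0 ≤ t * c - p x
      linarith)
    (by
      rintro ⟨y, d⟩
      obtain ⟨r, hr⟩ := hint y
      refine ⟨⟨(max r (-d) • x₀, max r (-d)), (hD _ _).2 (by simp)⟩, (hS _ _).2 ⟨?_, ?_⟩⟩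
      · have := K.add_mem hr (hsmul (sub_nonneg.2 (le_max_left r (-d))) hx₀)
        rwa [sub_smul, add_comm, ← add_assoc, sub_add_cancel] at this
      · linarith [le_max_right r (-d)])
  replace hq (x : E) (c : ℝ) (hx : F x = c • F x₀) : q (x, 0) + c * q (0, 1) = t * c - p x := by
    have h1 : q (x, c) = t * c - p x := hq ⟨(x, c), (hD x c).2 hx⟩
    rw [← h1, ← smul_eq_mul, ← map_smul, ← map_add]
    simp
  let u : Module.Dual ℝ E := q ∘ₗ LinearMap.inl ℝ E ℝ + p
  have hu : u ∈ LinearMap.range F.dualMap := by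
    rw [LinearMap.range_dualMap_eq_dualAnnihilator_ker, Submodule.mem_dualAnnihilator]
    intro x hx
    have := hq x 0 (by simpa using hx)
    simp only [u, LinearMap.add_apply, LinearMap.comp_apply, LinearMap.inl_apply]
    linarith
  obtain ⟨l, hl⟩ := hu
  have hlF (x : E) : l (F x) = q (x, 0) + p x := LinearMap.congr_fun hl x
  refine ⟨l, ?_, fun x hx => ?_⟩
  · have h1 := hq x₀ 1 (by simp)
    have h2 := hqpos (0, 1) ((hS _ _).2 ⟨K.zero_mem, zero_le_one⟩)
    rw [hlF]
    linarith
  · have := hqpos (x, 0) ((hS _ _).2 ⟨hx, le_rfl⟩)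
    rw [hlF]
    linarith

section Hermitian

variable {ι : Type*} [Fintype ι]

theorem trace_mul_im_eq_zero {A B : Matrix ι ι ℂ} (hA : A.IsHermitian) (hB : B.IsHermitian) :
    (A * B).trace.im = 0 := by
  rw [← Complex.conj_eq_iff_im, starRingEnd_apply, ← Matrix.trace_conjTranspose,
    Matrix.conjTranspose_mul, hA.eq, hB.eq, Matrix.trace_mul_comm]

/-- A matrix whose trace pairing with every Hermitian matrix is real is Hermitian. -/
theorem isHermitian_of_trace_mul_im_eq_zero {A : Matrix ι ι ℂ}
    (h : ∀ X : Matrix ι ι ℂ, X.IsHermitian → (A * X).trace.im = 0) : A.IsHermitian := by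
  have hB : ∀ X : Matrix ι ι ℂ, X.IsHermitian → ((Aᴴ - A) * X).trace = 0 := by
    intro X hX
    have h1 : (Aᴴ * X).trace = star (A * X).trace := by
      rw [← Matrix.trace_conjTranspose, Matrix.conjTranspose_mul, hX.eq, Matrix.trace_mul_comm]
    rw [sub_mul, Matrix.trace_sub, h1, sub_eq_zero]
    exact Complex.conj_eq_iff_im.2 (h X hX)
  have h2 := hB (Complex.I • (Aᴴ - A)) (by
    ext i j
    simp
    ring)
  have h3 : (Aᴴ - A)ᴴ = -(Aᴴ - A) := by simp
  have h4 : ((Aᴴ - A)ᴴ * (Aᴴ - A)).trace = 0 := by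
    rw [h3, neg_mul, Matrix.trace_neg]
    simpa using h2
  exact sub_eq_zero.1 (Matrix.trace_conjTranspose_mul_self_eq_zero_iff.1 h4)

theorem trace_mul_re_nonneg {A B : Matrix ι ι ℂ} (hA : A.PosSemidef) (hB : B.PosSemidef) :
    0 ≤ (A * B).trace.re := by
  classical
  open scoped MatrixOrder in
  obtain ⟨C, rfl⟩ := CStarAlgebra.nonneg_iff_eq_star_mul_self.1 hB.nonneg
  rw [Matrix.trace_mul_comm, mul_assoc, Matrix.trace_mul_comm]
  exact (Complex.le_def.1 (hA.mul_mul_conjTranspose_same C).trace_nonneg).1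

/-- Self-duality of the positive semidefinite cone. -/
theorem posSemidef_of_trace_mul_re_nonneg {A : Matrix ι ι ℂ} (hA : A.IsHermitian)
    (h : ∀ X : Matrix ι ι ℂ, X.PosSemidef → 0 ≤ (A * X).trace.re) : A.PosSemidef := by
  refine .of_dotProduct_mulVec_nonneg hA fun v => ?_
  have hv := Matrix.posSemidef_vecMulVec_self_star v
  have h1 : star v ⬝ᵥ (A *ᵥ v) = (A * Matrix.vecMulVec v (star v)).trace := by
    rw [Matrix.mul_vecMulVec, Matrix.trace_vecMulVec, dotProduct_comm]
  rw [h1]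
  exact Complex.le_def.2 ⟨h _ hv, (trace_mul_im_eq_zero hA hv.1).symm⟩

open scoped MatrixOrder Matrix.Norms.L2Operator in
/-- A positive definite matrix is an order unit. -/
theorem exists_smul_add_posSemidef {A B : Matrix ι ι ℂ} (hA : A.PosDef) (hB : B.IsHermitian) :
    ∃ r : ℝ, (r • A + B).PosSemidef := by
  classical
  cases isEmpty_or_nonempty ι
  · exact ⟨0, (Subsingleton.elim A ((0 : ℝ) • A + B)).rec hA.posSemidef⟩
  obtain ⟨c, hc, hcA⟩ := (CFC.exists_pos_algebraMap_le_iff (A := Matrix ι ι ℂ)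
    hA.isHermitian.isSelfAdjoint).2 fun x hx => hA.isStrictlyPositive.spectrum_pos hx
  have hB' := IsSelfAdjoint.neg_algebraMap_norm_le_self hB.isSelfAdjoint
  refine ⟨‖B‖ / c, Matrix.nonneg_iff_posSemidef.1 ?_⟩
  have h1 : algebraMap ℝ (Matrix ι ι ℂ) ‖B‖ ≤ (‖B‖ / c) • A := by
    have := Matrix.PosSemidef.smul (Matrix.le_iff.1 hcA) (show 0 ≤ ‖B‖ / c by positivity)
    rw [Matrix.le_iff]
    convert this using 1
    rw [smul_sub, Algebra.algebraMap_eq_smul_one, Algebra.algebraMap_eq_smul_one, smul_smul,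
      div_mul_cancel₀ _ hc.ne']
  simpa using add_le_add h1 hB'

/-- Every real functional on the Hermitian matrices is a trace pairing. -/
theorem exists_isHermitian_dual_eq_trace
    (l : Module.Dual ℝ (selfAdjoint.submodule ℝ (Matrix ι ι ℂ))) :
    ∃ A : Matrix ι ι ℂ, A.IsHermitian ∧ ∀ X, l X = (A * X.1).trace.re := by
  let T : selfAdjoint.submodule ℝ (Matrix ι ι ℂ) →ₗ[ℝ]
      Module.Dual ℝ (selfAdjoint.submodule ℝ (Matrix ι ι ℂ)) :=
    LinearMap.mk₂ ℝ (fun A X => (A.1 * X.1).trace.re)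
      (by simp [add_mul]) (by simp) (by simp [mul_add]) (by simp)
  have hT : Function.Injective T := by
    rw [injective_iff_map_eq_zero]
    intro A hA
    have hAh : A.1ᴴ = A.1 := A.2
    have h1 : (A.1 * A.1).trace.re = 0 := LinearMap.congr_fun hA A
    have h2 := trace_mul_im_eq_zero hAh hAh
    refine Subtype.ext (Matrix.trace_conjTranspose_mul_self_eq_zero_iff.1 ?_)
    rw [hAh]
    exact Complex.ext h1 h2
  obtain ⟨A, rfl⟩ := (LinearMap.injective_iff_surjective_of_finrank_eq_finrank
    Subspace.dual_finrank_eq.symm).1 hT l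
  exact ⟨A.1, A.2, fun X => rfl⟩

end Hermitian

/-- SDP duality for the epigraph of the support function of an SDP-represented
set `C = {Φ(X) : X ⪰ 0, F(X) = g}`, under strict feasibility. -/
theorem suppFn_epigraph_sdp_duality {s d f : ℕ}
    (Φ : Matrix (Fin s) (Fin s) ℂ → Matrix (Fin d) (Fin d) ℂ)
    (F : Matrix (Fin s) (Fin s) ℂ → Matrix (Fin f) (Fin f) ℂ)
    (g : Matrix (Fin f) (Fin f) ℂ)
    (hΦlin : IsLinearMap ℝ Φ) (hFlin : IsLinearMap ℝ F)
    (hΦherm : ∀ X : Matrix (Fin s) (Fin s) ℂ, X.IsHermitian → (Φ X).IsHermitian)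
    (hFherm : ∀ X : Matrix (Fin s) (Fin s) ℂ, X.IsHermitian → (F X).IsHermitian)
    (hgherm : g.IsHermitian)
    (Φstar : Matrix (Fin d) (Fin d) ℂ → Matrix (Fin s) (Fin s) ℂ)
    (Fstar : Matrix (Fin f) (Fin f) ℂ → Matrix (Fin s) (Fin s) ℂ)
    (hΦadj : ∀ (w : Matrix (Fin d) (Fin d) ℂ) (X : Matrix (Fin s) (Fin s) ℂ),
      w.IsHermitian → X.IsHermitian → (Φstar w * X).trace = (w * Φ X).trace)
    (hFadj : ∀ (lam : Matrix (Fin f) (Fin f) ℂ) (X : Matrix (Fin s) (Fin s) ℂ),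
      lam.IsHermitian → X.IsHermitian → (Fstar lam * X).trace = (lam * F X).trace)
    (hfeas : ∃ X₀ : Matrix (Fin s) (Fin s) ℂ, X₀.PosDef ∧ F X₀ = g)
    (w : Matrix (Fin d) (Fin d) ℂ) (hw : w.IsHermitian) (t : ℝ) :
    (⨆ (X : Matrix (Fin s) (Fin s) ℂ) (_ : X.PosSemidef ∧ F X = g),
        (((Φ X * w).trace).re : EReal)) ≤ (t : EReal) ↔
      ∃ lam : Matrix (Fin f) (Fin f) ℂ, lam.IsHermitian ∧
        ((lam * g).trace).re ≤ t ∧ (Fstar lam - Φstar w).PosSemidef := by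
  obtain ⟨X₀, hX₀, hFX₀⟩ := hfeas
  have hpair {lam : Matrix (Fin f) (Fin f) ℂ} (hlam : lam.IsHermitian)
      {X : Matrix (Fin s) (Fin s) ℂ} (hX : X.IsHermitian) :
      ((Fstar lam - Φstar w) * X).trace = (lam * F X).trace - (Φ X * w).trace := by
    rw [sub_mul, Matrix.trace_sub, hFadj lam X hlam hX, hΦadj w X hw hX,
      Matrix.trace_mul_comm w]
  constructor
  · intro hsup
    have hle : ∀ X : Matrix (Fin s) (Fin s) ℂ, X.PosSemidef → F X = g →
        (Φ X * w).trace.re ≤ t := fun X hX hFX =>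
      EReal.coe_le_coe_iff.1 ((le_iSup₂_of_le X ⟨hX, hFX⟩ le_rfl).trans hsup)
    let F' : selfAdjoint.submodule ℝ (Matrix (Fin s) (Fin s) ℂ) →ₗ[ℝ]
        selfAdjoint.submodule ℝ (Matrix (Fin f) (Fin f) ℂ) :=
      (hFlin.mk' F).restrict hFherm
    let p : selfAdjoint.submodule ℝ (Matrix (Fin s) (Fin s) ℂ) →ₗ[ℝ] ℝ :=
      { toFun := fun X => (Φ X.1 * w).trace.re
        map_add' := by simp [hΦlin.map_add, add_mul]
        map_smul' := by simp [hΦlin.map_smul] }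
    let K : PointedCone ℝ (selfAdjoint.submodule ℝ (Matrix (Fin s) (Fin s) ℂ)) :=
      { carrier := {X | X.1.PosSemidef}
        zero_mem' := Matrix.PosSemidef.zero
        add_mem' := fun hX hY => Matrix.PosSemidef.add hX hY
        smul_mem' := fun c _ hX => Matrix.PosSemidef.smul hX c.2 }
    obtain ⟨l, hlt, hl⟩ := exists_dual_certificate F' p K ⟨X₀, hX₀.isHermitian⟩ hX₀.posSemidef
      (fun Y => exists_smul_add_posSemidef hX₀ Y.2) t
      (fun X hX hFX => hle X.1 hX ((congrArg Subtype.val hFX).trans hFX₀))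
    obtain ⟨lam, hlam, hlamtr⟩ := exists_isHermitian_dual_eq_trace l
    refine ⟨lam, hlam, ?_, posSemidef_of_trace_mul_re_nonneg ?_ fun X hX => ?_⟩
    · rw [hlamtr] at hlt
      rwa [← hFX₀]
    · refine isHermitian_of_trace_mul_im_eq_zero fun X hX => ?_
      rw [hpair hlam hX, Complex.sub_im, trace_mul_im_eq_zero hlam (hFherm X hX),
        trace_mul_im_eq_zero (hΦherm X hX) hw, sub_zero]
    · have := hl ⟨X, hX.isHermitian⟩ hX
      rw [hlamtr] at this
      rw [hpair hlam hX.isHermitian, Complex.sub_re]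
      exact sub_nonneg.2 this
  · rintro ⟨lam, hlam, hlt, hpos⟩
    refine iSup₂_le fun X ⟨hX, hFX⟩ => EReal.coe_le_coe_iff.2 ?_
    have := trace_mul_re_nonneg hpos hX
    rw [hpair hlam hX.isHermitian, hFX, Complex.sub_re] at this
    linarith

end QIT
end
end
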